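/- For every composition σ ∈ C and every interval partition β of [0,1], m*_σ(β) = Σ over all tuples (ρ^{(r)})_{r ∈ A₀} with ρ^{(r)} ∈ C_{ℓ_r} of [ ∏_{r∈A₀} ℓ_r! / (ρ^{(r)}₁!⋯ρ^{(r)}_{ℓ(ρ^{(r)})}!) ] · m°_{ρ^{(0)} ⋆ ⋆_{j∈A} (σ_j ⋆ ρ^{(j)})}(β), where A := {j : σ_j ≥ 2}, A₀ := {0} ∪ A, ℓ₀ is the number of leading 1s of σ, ℓ_j (j ∈ A) is the number of consecutive 1s immediately following σ_j in σ, and ⋆ denotes concatenation of compositions (listing all parts in order, the blocks j ∈ A taken in increasing order). -/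

import Mathlib

open MeasureTheory Set

/-- `β` is an interval partition of `[0, M]`: a collection of disjoint open
subintervals of `[0, M]` (encoded by their endpoint pairs) whose union has
full Lebesgue measure in `[0, M]`. -/
def IsIntervalPartition (M : ℝ) (β : Set (ℝ × ℝ)) : Prop :=
  0 ≤ M ∧ (∀ p ∈ β, 0 ≤ p.1 ∧ p.1 < p.2 ∧ p.2 ≤ M) ∧
    β.PairwiseDisjoint (fun p => Set.Ioo p.1 p.2) ∧
    volume (Set.Icc (0 : ℝ) M \ ⋃ p ∈ β, Set.Ioo p.1 p.2) = 0

/-- A strictly increasing (in the left-to-right order) finite sequence of blocks. -/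
def BlocksStrictMono {n : ℕ} (U : Fin n → ℝ × ℝ) : Prop :=
  ∀ i j : Fin n, i < j → (U i).2 ≤ (U j).1

/-- `σ` is an integer composition of `n`: a finite list of positive integers summing
to `n`. -/
def IsComposition (n : ℕ) (σ : List ℕ) : Prop :=
  (∀ p ∈ σ, 1 ≤ p) ∧ σ.sum = n

/-- The quasi-symmetric monomial `m°_σ(β) = Σ_{U₁ < ⋯ < U_ℓ ∈ β} ∏_j Leb(U_j)^{σ_j}`,
summing over strictly increasing `ℓ(σ)`-tuples of blocks of `β`. -/
noncomputable def mCirc (σ : List ℕ) (β : Set (ℝ × ℝ)) : ℝ :=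
  ∑' U : {U : Fin σ.length → ℝ × ℝ // (∀ j, U j ∈ β) ∧ BlocksStrictMono U},
    ∏ j : Fin σ.length, ((U.1 j).2 - (U.1 j).1) ^ (σ.get j)

/-- The total mass of the blocks of `β` contained in `[u, v]`
(i.e. lying strictly between neighbouring chosen blocks). -/
noncomputable def massBetween (β : Set (ℝ × ℝ)) (u v : ℝ) : ℝ :=
  ∑' p : {p : ℝ × ℝ // p ∈ β ∧ u ≤ p.1 ∧ p.2 ≤ v}, (p.1.2 - p.1.1)

/-- `m*_σ(β)` for the composition
`σ = 1^{L 0} ⋆ s 0 ⋆ 1^{L 1} ⋆ s 1 ⋆ ⋯ ⋆ s (k-1) ⋆ 1^{L k}` (every composition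
decomposes uniquely in this way with all `s i ≥ 2`): the sum over strictly increasing
choices `U : Fin k → β` of
`‖β₀‖^{L 0} · ∏_i Leb(U i)^{s i} · ‖β_{i+1}‖^{L (i+1)}`, where `‖β_j‖` is the total
mass of the blocks of `β` between consecutive chosen blocks (or before the first /
after the last), and `M` is the total mass of `β`. -/
noncomputable def mStar (k : ℕ) (s : Fin k → ℕ) (L : Fin (k + 1) → ℕ) (M : ℝ)
    (β : Set (ℝ × ℝ)) : ℝ :=
  ∑' U : {U : Fin k → ℝ × ℝ // (∀ j, U j ∈ β) ∧ BlocksStrictMono U},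
    massBetween β 0 (if h : 0 < k then (U.1 ⟨0, h⟩).1 else M) ^ (L 0) *
      ∏ i : Fin k,
        (((U.1 i).2 - (U.1 i).1) ^ (s i) *
          massBetween β (U.1 i).2
              (if h : (i : ℕ) + 1 < k then (U.1 ⟨(i : ℕ) + 1, h⟩).1 else M) ^ (L i.succ))

namespace IntervalPartition

open scoped ENNReal Classical

/-- The block `p` belongs to `β` and lies in `[u, v]`. -/
def InRange (β : Set (ℝ × ℝ)) (u v : ℝ) (p : ℝ × ℝ) : Prop :=
  p ∈ β ∧ u ≤ p.1 ∧ p.2 ≤ v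

/-- The length of a block, as an extended nonnegative real. -/
noncomputable def len (p : ℝ × ℝ) : ℝ≥0∞ := ENNReal.ofReal (p.2 - p.1)

/-- Extended nonnegative version of `massBetween`. -/
noncomputable def eMass (β : Set (ℝ × ℝ)) (u v : ℝ) : ℝ≥0∞ :=
  ∑' p, if InRange β u v p then len p else 0

/-- Extended nonnegative version of `mCirc`, restricted to the blocks contained in `[u, v]`. -/
noncomputable def eCirc (β : Set (ℝ × ℝ)) : List ℕ → ℝ → ℝ → ℝ≥0∞
  | [], _, _ => 1
  | a :: σ, u, v => ∑' p, if InRange β u v p then len p ^ a * eCirc β σ p.2 v else 0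

/-- Extended nonnegative version of `mStar`, restricted to the blocks contained in `[u, v]`. -/
noncomputable def eStar (β : Set (ℝ × ℝ)) :
    (k : ℕ) → (Fin k → ℕ) → (Fin (k + 1) → ℕ) → ℝ → ℝ → ℝ≥0∞
  | 0, _, L, u, v => eMass β u v ^ L 0
  | k + 1, s, L, u, v => ∑' p, if InRange β u v p then
      eMass β u p.1 ^ L 0 * (len p ^ s 0 * eStar β k (Fin.tail s) (Fin.tail L) p.2 v) else 0

/-- The multinomial coefficient of the composition `ρ` of `n`, and `0` for other lists. -/
noncomputable def coeff (n : ℕ) (ρ : List ℕ) : ℝ≥0∞ :=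
  if IsComposition n ρ then
    ENNReal.ofReal ((n.factorial : ℝ) / ((ρ.map Nat.factorial).prod : ℝ)) else 0

/-- The part of the binomial expansion of `(w + r) ^ n` of positive degree in `w`. -/
def binomTail {R : Type*} [CommSemiring R] (n : ℕ) (w r : R) : R :=
  ∑ a ∈ Finset.range n, (n.choose (a + 1) : R) * (w ^ (a + 1) * r ^ (n - 1 - a))

theorem add_pow_eq_binomTail {R : Type*} [CommSemiring R] (n : ℕ) (w r : R) :
    (w + r) ^ n = binomTail n w r + r ^ n := by
  rw [add_pow, Finset.sum_range_succ', binomTail]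
  congr 1
  · refine Finset.sum_congr rfl fun a _ => ?_
    rw [show n - (a + 1) = n - 1 - a by omega]; ring
  · simp

theorem binomTail_succ {R : Type*} [CommSemiring R] (n : ℕ) (w r : R) :
    binomTail (n + 1) w r = (w + r) * binomTail n w r + w * r ^ n := by
  have h : binomTail (n + 1) w r = w * (w + r) ^ n + r * binomTail n w r := by
    have h1 : ∀ a ∈ Finset.range (n + 1),
        ((n + 1).choose (a + 1) : R) * (w ^ (a + 1) * r ^ (n + 1 - 1 - a)) =
          w * (w ^ a * r ^ (n - a) * (n.choose a : R)) +
          (n.choose (a + 1) : R) * (w ^ (a + 1) * r ^ (n - a)) := fun a _ => by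
      rw [Nat.choose_succ_succ, Nat.cast_add, Nat.add_sub_cancel]; ring
    rw [binomTail, Finset.sum_congr rfl h1, Finset.sum_add_distrib, ← Finset.mul_sum, ← add_pow,
      Finset.sum_range_succ, Nat.choose_succ_self, binomTail, Finset.mul_sum]
    simp only [Nat.cast_zero, zero_mul, add_zero]
    congr 1
    refine Finset.sum_congr rfl fun a ha => ?_
    rw [show n - a = n - 1 - a + 1 by have := Finset.mem_range.1 ha; omega]; ring
  rw [h, add_pow_eq_binomTail]; ring

theorem tsum_subtype_eq_ite {α : Type*} (P : α → Prop) [DecidablePred P] (f : α → ℝ≥0∞) :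
    ∑' x : {x // P x}, f x = ∑' x, if P x then f x else 0 := by
  refine (tsum_subtype {x | P x} f).trans (tsum_congr fun x => ?_)
  rw [Set.indicator_apply]
  exact if_congr Iff.rfl rfl rfl

theorem tsum_ite_mul_left {α : Type*} (P : α → Prop) [DecidablePred P] (c : ℝ≥0∞) (f : α → ℝ≥0∞) :
    c * (∑' x, if P x then f x else 0) = ∑' x, if P x then c * f x else 0 := by
  rw [← ENNReal.tsum_mul_left]; simp only [mul_ite, mul_zero]

theorem tsum_ite_mul_right {α : Type*} (P : α → Prop) [DecidablePred P] (c : ℝ≥0∞) (f : α → ℝ≥0∞) :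
    (∑' x, if P x then f x else 0) * c = ∑' x, if P x then f x * c else 0 := by
  rw [← ENNReal.tsum_mul_right]; simp only [ite_mul, zero_mul]

theorem ite_tsum {α : Type*} (P : Prop) [Decidable P] (f : α → ℝ≥0∞) :
    (if P then ∑' x, f x else 0) = ∑' x, if P then f x else 0 := by
  split_ifs <;> simp

theorem tsum_ite_add {α : Type*} (P : α → Prop) [DecidablePred P] (f g : α → ℝ≥0∞) :
    (∑' x, if P x then f x + g x else 0) =
      (∑' x, if P x then f x else 0) + ∑' x, if P x then g x else 0 := by
  rw [← ENNReal.tsum_add]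
  exact tsum_congr fun x => by split_ifs <;> simp

theorem tsum_fin_succ {α : Type*} (n : ℕ) (f : (Fin (n + 1) → α) → ℝ≥0∞) :
    ∑' U, f U = ∑' p, ∑' U : Fin n → α, f (Fin.cons p U) := by
  rw [← (Fin.consEquiv fun _ : Fin (n + 1) => α).tsum_eq, ENNReal.tsum_prod']
  rfl

theorem tsum_list {α : Type*} (f : List α → ℝ≥0∞) (h : f [] = 0) :
    ∑' l, f l = ∑' a, ∑' l, f (a :: l) := by
  rw [← ENNReal.tsum_prod (f := fun a l => f (a :: l))]
  refine (Function.Injective.tsum_eq (g := fun x : α × List α => x.1 :: x.2) ?_ ?_).symm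
  · rintro ⟨a, l⟩ ⟨b, m⟩ hab
    simpa using hab
  · rintro (_ | ⟨a, l⟩) hl
    · exact absurd h hl
    · exact ⟨(a, l), rfl⟩

theorem coeff_zero (ρ : List ℕ) : coeff 0 ρ = if ρ = [] then 1 else 0 := by
  rcases ρ with _ | ⟨a, ρ⟩
  · simp [coeff, IsComposition]
  · have : ¬ IsComposition 0 (a :: ρ) := fun h => by
      have h1 := h.1 a (by simp)
      have h2 := h.2
      simp at h2; omega
    simp [coeff, this]

theorem coeff_succ_nil (n : ℕ) : coeff (n + 1) [] = 0 := by
  simp [coeff, IsComposition]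

theorem coeff_cons_zero (n : ℕ) (ρ : List ℕ) : coeff n (0 :: ρ) = 0 := by
  simp [coeff, IsComposition]

theorem coeff_cons_of_lt {n a : ℕ} (h : n < a) (ρ : List ℕ) : coeff n (a :: ρ) = 0 := by
  refine if_neg fun hc => ?_
  have := hc.2
  simp at this; omega

theorem coeff_cons {n a : ℕ} (ha : 1 ≤ a) (h : a ≤ n) (ρ : List ℕ) :
    coeff n (a :: ρ) = n.choose a * coeff (n - a) ρ := by
  have hiff : IsComposition n (a :: ρ) ↔ IsComposition (n - a) ρ := by
    simp only [IsComposition, List.mem_cons, forall_eq_or_imp, List.sum_cons]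
    constructor
    · rintro ⟨⟨_, h1⟩, h2⟩; exact ⟨h1, by omega⟩
    · rintro ⟨h1, h2⟩; exact ⟨⟨ha, h1⟩, by omega⟩
  simp only [coeff, hiff]
  split_ifs
  · rw [← ENNReal.ofReal_natCast, ← ENNReal.ofReal_mul (by positivity)]
    congr 1
    rw [← Nat.choose_mul_factorial_mul_factorial h]
    have : (a.factorial : ℝ) ≠ 0 := by positivity
    push_cast [List.map_cons, List.prod_cons]
    rw [mul_assoc, mul_div_assoc, mul_div_mul_left _ _ this]
  · simp

section Partition

variable {M : ℝ} {β : Set (ℝ × ℝ)}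

theorem lt_of_mem (hβ : IsIntervalPartition M β) {p : ℝ × ℝ} (hp : p ∈ β) : p.1 < p.2 :=
  (hβ.2.1 p hp).2.1

theorem le_or_eq_or_le (hβ : IsIntervalPartition M β) {p q : ℝ × ℝ} (hp : p ∈ β) (hq : q ∈ β) :
    q.2 ≤ p.1 ∨ q = p ∨ p.2 ≤ q.1 := by
  by_contra! h
  obtain ⟨h1, h2, h3⟩ := h
  have hd := Set.disjoint_iff_inter_eq_empty.1 (hβ.2.2.1 hq hp h2)
  rw [Set.Ioo_inter_Ioo, Set.Ioo_eq_empty_iff] at hd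
  exact hd (max_lt (lt_min (lt_of_mem hβ hq) h3) (lt_min h1 (lt_of_mem hβ hp)))

theorem tsum_len_le (hβ : IsIntervalPartition M β) :
    ∑' p : β, len p ≤ ENNReal.ofReal M := by
  have h := tsum_meas_le_meas_iUnion_of_disjoint (volume : Measure ℝ)
    (As := fun p : β => Set.Ioo p.1.1 p.1.2) (fun _ => measurableSet_Ioo)
    (fun p q hpq => hβ.2.2.1 p.2 q.2 (fun h => hpq (Subtype.ext h)))
  simp only [Real.volume_Ioo] at h
  refine h.trans ((measure_mono (t := Set.Icc 0 M) ?_).trans ?_)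
  · refine Set.iUnion_subset fun p x hx => ?_
    obtain ⟨h0, _, h1⟩ := hβ.2.1 p p.2
    exact ⟨h0.trans hx.1.le, hx.2.le.trans h1⟩
  · simp

theorem eMass_le (hβ : IsIntervalPartition M β) (u v : ℝ) :
    eMass β u v ≤ ENNReal.ofReal M := by
  refine le_trans ?_ (tsum_len_le hβ)
  rw [tsum_subtype_eq_ite (fun p => p ∈ β)]
  refine ENNReal.tsum_le_tsum fun p => ?_
  by_cases h : InRange β u v p
  · simp [h, h.1]
  · simp [h]

theorem eMass_ne_top (hβ : IsIntervalPartition M β) (u v : ℝ) : eMass β u v ≠ ∞ :=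
  ne_top_of_le_ne_top ENNReal.ofReal_ne_top (eMass_le hβ u v)

theorem eCirc_le_one (hβ : IsIntervalPartition 1 β) (σ : List ℕ) (hσ : ∀ a ∈ σ, 1 ≤ a)
    (u v : ℝ) : eCirc β σ u v ≤ 1 := by
  induction σ generalizing u with
  | nil => simp [eCirc]
  | cons a σ ih =>
    refine le_trans ?_ ((eMass_le hβ u v).trans_eq ENNReal.ofReal_one)
    refine ENNReal.tsum_le_tsum fun p => ?_
    split_ifs with h
    · have hp := hβ.2.1 p h.1
      have h1 : len p ≤ 1 := ENNReal.ofReal_le_one.2 (by linarith)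
      calc len p ^ a * eCirc β σ p.2 v ≤ len p ^ 1 * 1 :=
            mul_le_mul' (pow_le_pow_right_of_le_one' h1 (hσ a (by simp)))
              (ih (fun b hb => hσ b (by simp [hb])) _)
        _ = len p := by simp
    · exact le_rfl

theorem eMass_split (hβ : IsIntervalPartition M β) {u v : ℝ} {p : ℝ × ℝ} (hp : InRange β u v p) :
    eMass β u v = eMass β u p.1 + (len p + eMass β p.2 v) := by
  have h1 : len p = ∑' q, if q = p then len q else 0 := by simp
  rw [h1, eMass, eMass, eMass, ← ENNReal.tsum_add, ← ENNReal.tsum_add]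
  refine tsum_congr fun q => ?_
  by_cases hq : q ∈ β
  · have hpl := lt_of_mem hβ hp.1
    have hql := lt_of_mem hβ hq
    have hpq := le_or_eq_or_le hβ hp.1 hq
    obtain ⟨-, hp1, hp2⟩ := hp
    simp only [InRange, hq, true_and]
    rcases hpq with h | rfl | h
    · have h2 : q ≠ p := by rintro rfl; linarith
      have h3 : ¬ p.2 ≤ q.1 := by linarith
      have h4 : q.2 ≤ v := by linarith
      simp [h, h2, h3, h4]
    · simp [hp1, hp2, not_le.2 hql]
    · have h2 : q ≠ p := by rintro rfl; linarith
      have h3 : ¬ q.2 ≤ p.1 := by linarith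
      have h4 : u ≤ q.1 := by linarith
      simp [h, h2, h3, h4]
  · have h2 : q ≠ p := by rintro rfl; exact hq hp.1
    simp [InRange, hq, h2]

/-- Swapping the order of summation over pairs of consecutive blocks in `[u, v]`. -/
theorem tsum_swap (hβ : IsIntervalPartition M β) (u v : ℝ) (f : ℝ × ℝ → ℝ × ℝ → ℝ≥0∞) :
    (∑' p, if InRange β u v p then ∑' q, if InRange β p.2 v q then f p q else 0 else 0) =
      ∑' q, if InRange β u v q then ∑' p, if InRange β u q.1 p then f p q else 0 else 0 := by
  simp only [ite_tsum]
  rw [ENNReal.tsum_comm]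
  refine tsum_congr fun q => tsum_congr fun p => ?_
  rw [← ite_and, ← ite_and]
  refine if_congr ?_ rfl rfl
  constructor
  · rintro ⟨⟨hp, h1, h2⟩, hq, h3, h4⟩
    have := lt_of_mem hβ hp
    exact ⟨⟨hq, by linarith, h4⟩, hp, h1, h3⟩
  · rintro ⟨⟨hq, h1, h2⟩, hp, h3, h4⟩
    have := lt_of_mem hβ hq
    exact ⟨⟨hp, h3, by linarith⟩, hq, h4, h2⟩

theorem eCirc_append_cons (hβ : IsIntervalPartition M β) (σ : List ℕ) (a : ℕ) (τ : List ℕ)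
    (u v : ℝ) : eCirc β (σ ++ a :: τ) u v =
      ∑' p, if InRange β u v p then eCirc β σ u p.1 * (len p ^ a * eCirc β τ p.2 v) else 0 := by
  induction σ generalizing u with
  | nil => simp [eCirc]
  | cons b σ ih =>
    simp only [List.cons_append, eCirc, ih, tsum_ite_mul_left, tsum_ite_mul_right]
    rw [tsum_swap hβ]
    simp only [mul_assoc]

theorem eMass_pow_succ (hβ : IsIntervalPartition M β) (n : ℕ) (u v : ℝ) :
    eMass β u v ^ (n + 1) =
      ∑' p, if InRange β u v p then binomTail (n + 1) (len p) (eMass β p.2 v) else 0 := by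
  induction n generalizing u with
  | zero => simp [binomTail, eMass]
  | succ n ih =>
    have h1 : ∀ p, (if InRange β u v p then
        eMass β u v * binomTail (n + 1) (len p) (eMass β p.2 v) else 0) =
        if InRange β u v p then eMass β u p.1 * binomTail (n + 1) (len p) (eMass β p.2 v) +
          (len p + eMass β p.2 v) * binomTail (n + 1) (len p) (eMass β p.2 v) else 0 := by
      intro p
      split_ifs with hp
      · rw [← add_mul, ← eMass_split hβ hp]
      · rfl
    have h2 : (∑' p, if InRange β u v p then
        eMass β u p.1 * binomTail (n + 1) (len p) (eMass β p.2 v) else 0) =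
        ∑' q, if InRange β u v q then len q * eMass β q.2 v ^ (n + 1) else 0 := by
      simp only [ih, tsum_ite_mul_left]
      rw [tsum_swap hβ]
      simp only [eMass, tsum_ite_mul_right]
    rw [pow_succ', ih, tsum_ite_mul_left, tsum_congr h1, tsum_ite_add, h2, ← tsum_ite_add]
    refine tsum_congr fun p => ?_
    rw [binomTail_succ (n + 1), add_comm]

theorem eMass_pow_eq_tsum (hβ : IsIntervalPartition M β) (n : ℕ) (u v : ℝ) :
    eMass β u v ^ n = ∑' ρ, coeff n ρ * eCirc β ρ u v := by
  induction n using Nat.strong_induction_on generalizing u with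
  | _ n ih =>
  rcases n with _ | n
  · simp only [coeff_zero, ite_mul, zero_mul, tsum_ite_eq]
    simp [eCirc]
  · have hsum : ∀ a ∈ Finset.range (n + 1),
        ∑' ρ, coeff (n + 1) ((a + 1) :: ρ) * eCirc β ((a + 1) :: ρ) u v =
          ∑' p, if InRange β u v p then ((n + 1).choose (a + 1) : ℝ≥0∞) *
            (len p ^ (a + 1) * eMass β p.2 v ^ (n + 1 - 1 - a)) else 0 := by
      intro a ha
      have ha := Finset.mem_range.1 ha
      simp only [coeff_cons (Nat.le_add_left 1 a) (show a + 1 ≤ n + 1 by omega), eCirc,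
        tsum_ite_mul_left]
      rw [ENNReal.tsum_comm]
      refine tsum_congr fun p => ?_
      rw [ih (n + 1 - 1 - a) (by omega), ← ite_tsum, ← ENNReal.tsum_mul_left,
        ← ENNReal.tsum_mul_left]
      congr 1
      refine tsum_congr fun ρ => ?_
      rw [show n + 1 - 1 - a = n + 1 - (a + 1) by omega]
      ring
    rw [eMass_pow_succ hβ, tsum_list _ (by simp [coeff_succ_nil]),
      tsum_eq_zero_add' ENNReal.summable]
    simp only [coeff_cons_zero, zero_mul, tsum_zero, zero_add]
    rw [tsum_eq_sum (s := Finset.range (n + 1)), Finset.sum_congr rfl hsum,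
      ← Summable.tsum_finsetSum fun _ _ => ENNReal.summable]
    · refine tsum_congr fun p => ?_
      split_ifs <;> simp [binomTail]
    · intro a ha
      simp [coeff_cons_of_lt (show n + 1 < a + 1 by simpa using ha)]

/-- The concatenation `ρ⁽⁰⁾ ⋆ s₀ ⋆ ρ⁽¹⁾ ⋆ ⋯`. -/
def interleave {k : ℕ} (s : Fin k → ℕ) (ρ : Fin (k + 1) → List ℕ) : List ℕ :=
  ρ 0 ++ (List.ofFn fun i : Fin k => s i :: ρ i.succ).flatten

theorem interleave_cons {k : ℕ} (s : Fin (k + 1) → ℕ) (σ : List ℕ) (ρ : Fin (k + 1) → List ℕ) :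
    interleave s (Fin.cons σ ρ) = σ ++ s 0 :: interleave (Fin.tail s) ρ := by
  simp [interleave, List.ofFn_succ, Fin.tail]

theorem eStar_eq_tsum (hβ : IsIntervalPartition M β) (k : ℕ) (s : Fin k → ℕ)
    (L : Fin (k + 1) → ℕ) (u v : ℝ) :
    eStar β k s L u v =
      ∑' ρ : Fin (k + 1) → List ℕ, (∏ r, coeff (L r) (ρ r)) * eCirc β (interleave s ρ) u v := by
  induction k generalizing u with
  | zero =>
    rw [tsum_fin_succ, eStar, eMass_pow_eq_tsum hβ]
    refine tsum_congr fun ρ => ?_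
    simp [interleave]
  | succ k ih =>
    rw [tsum_fin_succ, eStar]
    simp only [Fin.prod_univ_succ (n := k + 1), Fin.cons_zero, Fin.cons_succ, interleave_cons,
      eCirc_append_cons hβ, tsum_ite_mul_left, ih, eMass_pow_eq_tsum hβ (L 0)]
    rw [tsum_congr fun σ => ENNReal.tsum_comm, ENNReal.tsum_comm]
    refine tsum_congr fun p => ?_
    split_ifs
    · rw [← ENNReal.tsum_mul_right]
      refine tsum_congr fun σ => ?_
      rw [← ENNReal.tsum_mul_left, ← ENNReal.tsum_mul_left]
      refine tsum_congr fun ρ => ?_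
      simp only [Fin.tail]
      ring
    · simp

theorem cons_mem_iff (hβ : IsIntervalPartition 1 β) {n : ℕ} (u : ℝ) (p : ℝ × ℝ)
    (U : Fin n → ℝ × ℝ) :
    ((∀ j, InRange β u 1 ((Fin.cons p U : Fin (n + 1) → ℝ × ℝ) j)) ∧
        BlocksStrictMono (Fin.cons p U : Fin (n + 1) → ℝ × ℝ)) ↔
      InRange β u 1 p ∧ (∀ j, InRange β p.2 1 (U j)) ∧ BlocksStrictMono U := by
  simp only [BlocksStrictMono, Fin.forall_fin_succ, Fin.cons_zero, Fin.cons_succ,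
    Fin.succ_pos, Fin.not_lt_zero, Fin.succ_lt_succ_iff, false_imp_iff, true_imp_iff, true_and]
  constructor
  · rintro ⟨⟨hp, hU⟩, hpU, hm⟩
    exact ⟨hp, fun j => ⟨(hU j).1, hpU j, (hU j).2.2⟩, hm⟩
  · rintro ⟨hp, hU, hm⟩
    have := lt_of_mem hβ hp.1
    exact ⟨⟨hp, fun j => ⟨(hU j).1, by linarith [(hU j).2.1, hp.2.1], (hU j).2.2⟩⟩,
      fun j => (hU j).2.1, hm⟩

theorem eCirc_eq_tsum (hβ : IsIntervalPartition 1 β) (σ : List ℕ) (u : ℝ) :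
    eCirc β σ u 1 = ∑' U : Fin σ.length → ℝ × ℝ,
      if (∀ j, InRange β u 1 (U j)) ∧ BlocksStrictMono U then
        ∏ j, len (U j) ^ σ.get j else 0 := by
  induction σ generalizing u with
  | nil =>
    rw [tsum_eq_single (default : Fin ([] : List ℕ).length → ℝ × ℝ)
      fun U hU => absurd (funext fun j => j.elim0) hU]
    rw [if_pos ⟨fun j => j.elim0, fun i => i.elim0⟩]
    exact (Finset.prod_empty).symm
  | cons a σ ih =>
    simp only [List.length_cons]
    rw [tsum_fin_succ]
    simp only [cons_mem_iff hβ, eCirc, ih]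
    refine tsum_congr fun p => ?_
    rw [tsum_ite_mul_left, ite_tsum]
    refine tsum_congr fun U => ?_
    rw [← ite_and]
    refine if_congr Iff.rfl ?_ rfl
    rw [Fin.prod_univ_succ]
    rfl

theorem eStar_unfold (hβ : IsIntervalPartition 1 β) (k : ℕ) (s : Fin k → ℕ)
    (L : Fin (k + 1) → ℕ) (u : ℝ) :
    eStar β k s L u 1 = ∑' U : Fin k → ℝ × ℝ,
      if (∀ j, InRange β u 1 (U j)) ∧ BlocksStrictMono U then
        eMass β u (if h : 0 < k then (U ⟨0, h⟩).1 else 1) ^ L 0 *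
          ∏ i : Fin k, (len (U i) ^ s i *
            eMass β (U i).2 (if h : (i : ℕ) + 1 < k then (U ⟨(i : ℕ) + 1, h⟩).1 else 1) ^
              L i.succ) else 0 := by
  induction k generalizing u with
  | zero =>
    rw [tsum_eq_single (default : Fin 0 → ℝ × ℝ)
      fun U hU => absurd (funext fun j => j.elim0) hU]
    rw [if_pos ⟨fun j => j.elim0, fun i => i.elim0⟩]
    simp [eStar]
  | succ k ih =>
    rw [tsum_fin_succ]
    simp only [cons_mem_iff hβ, eStar, ih]
    refine tsum_congr fun p => ?_
    rw [tsum_ite_mul_left, tsum_ite_mul_left, ite_tsum]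
    refine tsum_congr fun U => ?_
    rw [← ite_and]
    refine if_congr Iff.rfl ?_ rfl
    have hcons : ∀ (i : ℕ) (h : i + 1 < k + 1),
        (Fin.cons p U : Fin (k + 1) → ℝ × ℝ) ⟨i + 1, h⟩ = U ⟨i, Nat.lt_of_succ_lt_succ h⟩ :=
      fun i h => rfl
    rw [Fin.prod_univ_succ]
    simp only [Fin.cons_zero, Fin.cons_succ, Fin.tail, Fin.val_succ, Fin.val_zero, hcons,
      Nat.add_lt_add_iff_right, Nat.zero_lt_succ, dif_pos, Fin.zero_eta, mul_assoc,
      Fin.succ_zero_eq_one]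

theorem toReal_len (hβ : IsIntervalPartition M β) {p : ℝ × ℝ} (hp : p ∈ β) :
    (len p).toReal = p.2 - p.1 :=
  ENNReal.toReal_ofReal (sub_nonneg.2 (lt_of_mem hβ hp).le)

theorem massBetween_eq (hβ : IsIntervalPartition M β) (u v : ℝ) :
    massBetween β u v = (eMass β u v).toReal := by
  have h := tsum_subtype_eq_ite (InRange β u v) len
  rw [eMass, ← h, ENNReal.tsum_toReal_eq fun p => ?_]
  · exact tsum_congr fun p => (toReal_len hβ p.2.1).symm
  · exact ENNReal.ofReal_ne_top

theorem inRange_zero_one_iff (hβ : IsIntervalPartition 1 β) (p : ℝ × ℝ) :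
    InRange β 0 1 p ↔ p ∈ β :=
  ⟨fun h => h.1, fun h => ⟨h, (hβ.2.1 p h).1, (hβ.2.1 p h).2.2⟩⟩

theorem mCirc_eq (hβ : IsIntervalPartition 1 β) (σ : List ℕ) :
    mCirc σ β = (eCirc β σ 0 1).toReal := by
  rw [eCirc_eq_tsum hβ]
  simp only [inRange_zero_one_iff hβ]
  rw [← tsum_subtype_eq_ite, ENNReal.tsum_toReal_eq]
  · refine tsum_congr fun U => ?_
    rw [ENNReal.toReal_prod]
    refine Finset.prod_congr rfl fun j _ => ?_
    rw [ENNReal.toReal_pow, toReal_len hβ (U.2.1 j)]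
  · exact fun U => ENNReal.prod_ne_top fun j _ => ENNReal.pow_ne_top ENNReal.ofReal_ne_top

theorem mStar_eq (hβ : IsIntervalPartition 1 β) (k : ℕ) (s : Fin k → ℕ) (L : Fin (k + 1) → ℕ) :
    mStar k s L 1 β = (eStar β k s L 0 1).toReal := by
  rw [eStar_unfold hβ]
  simp only [inRange_zero_one_iff hβ]
  rw [← tsum_subtype_eq_ite, ENNReal.tsum_toReal_eq]
  · refine tsum_congr fun U => ?_
    rw [ENNReal.toReal_mul, ENNReal.toReal_prod, ENNReal.toReal_pow, massBetween_eq hβ]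
    congr 1
    refine Finset.prod_congr rfl fun j _ => ?_
    rw [ENNReal.toReal_mul, ENNReal.toReal_pow, ENNReal.toReal_pow, toReal_len hβ (U.2.1 j),
      massBetween_eq hβ]
  · exact fun U => ENNReal.mul_ne_top (ENNReal.pow_ne_top (eMass_ne_top hβ _ _))
      (ENNReal.prod_ne_top fun j _ => ENNReal.mul_ne_top
        (ENNReal.pow_ne_top ENNReal.ofReal_ne_top) (ENNReal.pow_ne_top (eMass_ne_top hβ _ _)))

theorem prod_coeff {k : ℕ} (L : Fin (k + 1) → ℕ) (ρ : Fin (k + 1) → List ℕ) :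
    ∏ r, coeff (L r) (ρ r) = if ∀ r, IsComposition (L r) (ρ r) then
      ENNReal.ofReal (∏ r, ((L r).factorial : ℝ) / (((ρ r).map Nat.factorial).prod : ℝ)) else 0 := by
  split_ifs with h
  · rw [ENNReal.ofReal_prod_of_nonneg fun r _ => by positivity]
    exact Finset.prod_congr rfl fun r _ => if_pos (h r)
  · obtain ⟨r, hr⟩ := not_forall.1 h
    exact Finset.prod_eq_zero (Finset.mem_univ r) (if_neg hr)

end Partition

end IntervalPartition

/-- For an interval partition `β` of `[0,1]` and a composition
`σ = 1^{L 0} ⋆ s 0 ⋆ 1^{L 1} ⋆ ⋯ ⋆ s (k-1) ⋆ 1^{L k}` with all `s i ≥ 2`: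
`m*_σ(β) = Σ_{(ρ^{(r)})_{r ∈ A₀}, ρ^{(r)} ∈ C_{ℓ_r}}
  (∏_r ℓ_r!/(ρ^{(r)}₁!⋯)) · m°_{ρ^{(0)} ⋆ ⋆_j (σ_j ⋆ ρ^{(j)})}(β)`. -/
theorem mStar_eq_sum_mCirc (β : Set (ℝ × ℝ)) (hβ : IsIntervalPartition 1 β)
    (k : ℕ) (s : Fin k → ℕ) (L : Fin (k + 1) → ℕ) (hs : ∀ i, 2 ≤ s i) :
    mStar k s L 1 β =
      ∑' ρ : {ρ : Fin (k + 1) → List ℕ // ∀ r, IsComposition (L r) (ρ r)},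
        (∏ r : Fin (k + 1),
            ((L r).factorial : ℝ) / (((ρ.1 r).map Nat.factorial).prod : ℝ)) *
          mCirc (ρ.1 0 ++ (List.ofFn fun i : Fin k => s i :: ρ.1 i.succ).flatten) β := by
  have h1 : ∀ ρ : {ρ : Fin (k + 1) → List ℕ // ∀ r, IsComposition (L r) (ρ r)},
      ∀ a ∈ IntervalPartition.interleave s ρ.1, 1 ≤ a := by
    intro ρ a ha
    simp only [IntervalPartition.interleave, List.mem_append, List.mem_flatten, List.mem_ofFn] at ha
    rcases ha with ha | ⟨_, ⟨i, rfl⟩, ha⟩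
    · exact (ρ.2 0).1 a ha
    · rcases List.mem_cons.1 ha with rfl | ha
      · exact one_le_two.trans (hs i)
      · exact (ρ.2 i.succ).1 a ha
  rw [IntervalPartition.mStar_eq hβ, IntervalPartition.eStar_eq_tsum hβ]
  simp only [IntervalPartition.prod_coeff, ite_mul, zero_mul]
  rw [← IntervalPartition.tsum_subtype_eq_ite, ENNReal.tsum_toReal_eq]
  · refine tsum_congr fun ρ => ?_
    rw [ENNReal.toReal_mul, ENNReal.toReal_ofReal (by positivity), IntervalPartition.mCirc_eq hβ]
    rfl
  · exact fun ρ => ENNReal.mul_ne_top ENNReal.ofReal_ne_top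
      (ne_top_of_le_ne_top ENNReal.one_ne_top (IntervalPartition.eCirc_le_one hβ _ (h1 ρ) _ _))
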